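/- Let n ≥ 4 and l ≥ 1 be integers and let p ∈ P_n. If (u_0, …, u_{2l+1}) is an inscribed equilateral (2l+1)-pointed star of side length r based at p with 0 < r < r_n, and (u'_0, …, u'_{2l+1}) is an inscribed equilateral (2l+1)-pointed star of side length r' based at p with 0 < r' < r_n, then r = r' and u_i = u'_i for all i. -/

import Mathlib

noncomputable section

/-- The primitive `n`-th root of unity `ω = exp(2πi/n)`. -/
def nroot (n : ℕ) : ℂ := Complex.exp (2 * Real.pi * Complex.I / n)

/-- The boundary of the regular `n`-gon inscribed in the unit circle, as a subset of `ℂ`: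
the union of the closed segments from `ω^j` to `ω^(j+1)` for `j = 0, …, n-1`. -/
def polygon (n : ℕ) : Set ℂ :=
  ⋃ j ∈ Finset.range n, segment ℝ ((nroot n) ^ j) ((nroot n) ^ (j + 1))

/-- The critical scale `r_n`: `2 cos(π/n)` for even `n`,
and `1 + cos(2π/n)/cos(π/n)` for odd `n`. -/
def rpoly (n : ℕ) : ℝ :=
  if Even n then 2 * Real.cos (Real.pi / n)
  else 1 + Real.cos (2 * Real.pi / n) / Real.cos (Real.pi / n)

/-- Arc-length parametrization of the polygon `P_n` by the parameter `t` (normalized so that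
`t ∈ [0,1)` traverses the polygon once counterclockwise, with vertices at `t = j/n`). -/
def polyParam (n : ℕ) (t : ℝ) : ℂ :=
  ((1 - Int.fract (n * t) : ℝ) : ℂ) * (nroot n) ^ (⌊(n : ℝ) * t⌋) +
    ((Int.fract (n * t) : ℝ) : ℂ) * (nroot n) ^ (⌊(n : ℝ) * t⌋ + 1)

/-- The parameter value in `[0,1)` of a point `x ∈ P_n`. -/
def polyArg (n : ℕ) (x : ℂ) : ℝ :=
  sInf {t : ℝ | t ∈ Set.Ico (0 : ℝ) 1 ∧ polyParam n t = x}

/-- The normalized counterclockwise arc distance from `x` to `y` along `P_n`: the length of the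
counterclockwise path along `P_n` from `x` to `y` divided by the total perimeter of `P_n`. -/
def polyDist (n : ℕ) (x y : ℂ) : ℝ := Int.fract (polyArg n y - polyArg n x)

/-- `z` is strictly counterclockwise-between `x` and `y` on `P_n`. -/
def SCCWBtw (n : ℕ) (x z y : ℂ) : Prop :=
  0 < polyDist n x z ∧ polyDist n x z < polyDist n x y

/-- An inscribed equilateral `(2l+1)`-pointed star of side length `r` based at `p ∈ P_n`:
a tuple `(u 0, …, u (2l+1))` of points of `P_n` with `u 0 = u (2l+1) = p`, where consecutive
points are at Euclidean distance `r`, every point of `P_n` strictly counterclockwise-between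
`u i` and `u (i+1)` is at distance `< r` from `u i`, and the total winding number is `l`. -/
def IsStar (n l : ℕ) (r : ℝ) (p : ℂ) (u : ℕ → ℂ) : Prop :=
  u 0 = p ∧ u (2 * l + 1) = p ∧
  (∀ i ≤ 2 * l + 1, u i ∈ polygon n) ∧
  (∀ i ≤ 2 * l, dist (u i) (u (i + 1)) = r) ∧
  (∀ i ≤ 2 * l, ∀ z ∈ polygon n, SCCWBtw n (u i) z (u (i + 1)) → dist (u i) z < r) ∧
  (∑ i ∈ Finset.range (2 * l + 1), polyDist n (u i) (u (i + 1))) = (l : ℝ)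

/-- `x` is a vertex of `P_n`. -/
def IsVertex (n : ℕ) (x : ℂ) : Prop := ∃ j < n, x = (nroot n) ^ j

/-- `x` is the midpoint of an edge of `P_n`. -/
def IsMidpoint (n : ℕ) (x : ℂ) : Prop :=
  ∃ j < n, x = ((nroot n) ^ j + (nroot n) ^ (j + 1)) / 2

end

/-- The parametrization of `P_n` at unit speed per edge, with vertices at the integers. -/
noncomputable def polyCurve (n : ℕ) (s : ℝ) : ℂ :=
  ((1 - Int.fract s : ℝ) : ℂ) * (nroot n) ^ ⌊s⌋ + ((Int.fract s : ℝ) : ℂ) * (nroot n) ^ (⌊s⌋ + 1)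

lemma polyParam_eq_polyCurve (n : ℕ) (t : ℝ) : polyParam n t = polyCurve n (n * t) := rfl

lemma nroot_ne_zero (n : ℕ) : nroot n ≠ 0 := Complex.exp_ne_zero _

lemma norm_nroot (n : ℕ) : ‖nroot n‖ = 1 := by
  have : (2 * Real.pi * Complex.I / n : ℂ) = ((2 * Real.pi / n : ℝ) : ℂ) * Complex.I := by
    push_cast; ring
  rw [nroot, this, Complex.norm_exp_ofReal_mul_I]

lemma norm_nroot_zpow (n : ℕ) (k : ℤ) : ‖nroot n ^ k‖ = 1 := by
  rw [norm_zpow, norm_nroot, one_zpow]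

lemma nroot_pow_self {n : ℕ} (hn : n ≠ 0) : nroot n ^ n = 1 := by
  have h : (n : ℂ) ≠ 0 := by exact_mod_cast hn
  rw [nroot, ← Complex.exp_nat_mul, mul_div_cancel₀ _ h, Complex.exp_two_pi_mul_I]

lemma polyCurve_add_int (n : ℕ) (s : ℝ) (k : ℤ) :
    polyCurve n (s + k) = nroot n ^ k * polyCurve n s := by
  have h := nroot_ne_zero n
  simp only [polyCurve, Int.floor_add_intCast, Int.fract_add_intCast, zpow_add₀ h]
  ring

lemma polyCurve_add_int_mul {n : ℕ} (hn : n ≠ 0) (s : ℝ) (k : ℤ) :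
    polyCurve n (s + n * k) = polyCurve n s := by
  have h := polyCurve_add_int n s (n * k)
  rw [zpow_mul, zpow_natCast, nroot_pow_self hn, one_zpow, one_mul] at h
  rw [← h]; push_cast; rfl

lemma dist_polyCurve_add_int (n : ℕ) (s t : ℝ) (k : ℤ) :
    dist (polyCurve n (s + k)) (polyCurve n (t + k)) = dist (polyCurve n s) (polyCurve n t) := by
  rw [polyCurve_add_int, polyCurve_add_int, dist_eq_norm, ← mul_sub, norm_mul, norm_nroot_zpow,
    one_mul, dist_eq_norm]

lemma polyCurve_eq_of_mem_Icc (n : ℕ) (k : ℤ) {s : ℝ} (h0 : k ≤ s) (h1 : s ≤ k + 1) :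
    polyCurve n s =
      ((1 - (s - k) : ℝ) : ℂ) * nroot n ^ k + ((s - k : ℝ) : ℂ) * nroot n ^ (k + 1) := by
  rcases h1.lt_or_eq with h1 | rfl
  · have hf : ⌊s⌋ = k := Int.floor_eq_iff.2 ⟨h0, h1⟩
    simp only [polyCurve, Int.fract, hf]
  · have hf : ⌊(k : ℝ) + 1⌋ = k + 1 := by
      rw [Int.floor_eq_iff]; push_cast; constructor <;> linarith
    simp [polyCurve, Int.fract, hf]

lemma continuous_polyCurve (n : ℕ) : Continuous (polyCurve n) := by
  have haff (k : ℤ) : Continuous fun s : ℝ ↦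
      ((1 - (s - k) : ℝ) : ℂ) * nroot n ^ k + ((s - k : ℝ) : ℂ) * nroot n ^ (k + 1) := by
    fun_prop
  refine continuous_iff_continuousAt.2 fun x ↦ continuousAt_iff_continuous_left_right.2 ⟨?_, ?_⟩
  · have h1 := Int.ceil_lt_add_one x
    have h2 := Int.le_ceil x
    refine ((haff (⌈x⌉ - 1)).continuousWithinAt (x := x)).congr_of_eventuallyEq ?_ ?_
    · have : Set.Icc ((⌈x⌉ - 1 : ℤ) : ℝ) x ∈ nhdsWithin x (Set.Iic x) :=
        Icc_mem_nhdsLE (by push_cast; linarith)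
      filter_upwards [this] with s hs
      exact polyCurve_eq_of_mem_Icc n _ hs.1 (by push_cast; linarith [hs.2])
    · exact polyCurve_eq_of_mem_Icc n _ (by push_cast; linarith) (by push_cast; linarith)
  · have h1 := Int.floor_le x
    have h2 := Int.lt_floor_add_one x
    refine ((haff ⌊x⌋).continuousWithinAt (x := x)).congr_of_eventuallyEq ?_ ?_
    · filter_upwards [Icc_mem_nhdsGE h2] with s hs
      exact polyCurve_eq_of_mem_Icc n _ (h1.trans hs.1) hs.2
    · exact polyCurve_eq_of_mem_Icc n _ h1 h2.le

/-- The rotation taking the midpoint direction of the edge from `1` to `ω` to the positive real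
axis. -/
noncomputable def midRot (n : ℕ) : ℂ := Complex.exp ((-(Real.pi / n) : ℝ) * Complex.I)

lemma norm_midRot (n : ℕ) : ‖midRot n‖ = 1 := Complex.norm_exp_ofReal_mul_I _

lemma midRot_mul_nroot_zpow (n : ℕ) (k : ℤ) :
    midRot n * nroot n ^ k = Complex.exp (((2 * k - 1) * (Real.pi / n) : ℝ) * Complex.I) := by
  rw [midRot, nroot, ← Complex.exp_int_mul, ← Complex.exp_add]
  congr 1; push_cast; ring

lemma midRot_mul_polyCurve_re (n : ℕ) (k : ℤ) {s : ℝ} (h0 : k ≤ s) (h1 : s ≤ k + 1) :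
    (midRot n * polyCurve n s).re = (1 - (s - k)) * Real.cos ((2 * k - 1) * (Real.pi / n)) +
      (s - k) * Real.cos ((2 * k + 1) * (Real.pi / n)) := by
  rw [polyCurve_eq_of_mem_Icc n k h0 h1, mul_add, mul_left_comm, mul_left_comm (midRot n),
    midRot_mul_nroot_zpow, midRot_mul_nroot_zpow, Complex.add_re, Complex.re_ofReal_mul,
    Complex.re_ofReal_mul, Complex.exp_ofReal_mul_I_re, Complex.exp_ofReal_mul_I_re]
  push_cast; ring_nf

lemma midRot_mul_polyCurve_im (n : ℕ) (k : ℤ) {s : ℝ} (h0 : k ≤ s) (h1 : s ≤ k + 1) :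
    (midRot n * polyCurve n s).im = (1 - (s - k)) * Real.sin ((2 * k - 1) * (Real.pi / n)) +
      (s - k) * Real.sin ((2 * k + 1) * (Real.pi / n)) := by
  rw [polyCurve_eq_of_mem_Icc n k h0 h1, mul_add, mul_left_comm, mul_left_comm (midRot n),
    midRot_mul_nroot_zpow, midRot_mul_nroot_zpow, Complex.add_im, Complex.im_ofReal_mul,
    Complex.im_ofReal_mul, Complex.exp_ofReal_mul_I_im, Complex.exp_ofReal_mul_I_im]
  push_cast; ring_nf

lemma midRot_mul_polyCurve_re_zero (n : ℕ) {s : ℝ} (h0 : 0 ≤ s) (h1 : s ≤ 1) :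
    (midRot n * polyCurve n s).re = Real.cos (Real.pi / n) := by
  rw [midRot_mul_polyCurve_re n 0 (by simpa using h0) (by simpa using h1)]
  simp; ring

lemma midRot_mul_polyCurve_im_zero (n : ℕ) {s : ℝ} (h0 : 0 ≤ s) (h1 : s ≤ 1) :
    (midRot n * polyCurve n s).im = (2 * s - 1) * Real.sin (Real.pi / n) := by
  rw [midRot_mul_polyCurve_im n 0 (by simpa using h0) (by simpa using h1)]
  simp; ring

lemma sin_le_sin_of_mem_Icc {a b : ℝ} (ha : 0 ≤ a) (h1 : a ≤ b) (h2 : b ≤ Real.pi - a) :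
    Real.sin a ≤ Real.sin b := by
  rcases le_total b (Real.pi / 2) with h | h
  · exact Real.sin_le_sin_of_le_of_le_pi_div_two (by linarith) h h1
  · rw [← Real.sin_pi_sub b]
    exact Real.sin_le_sin_of_le_of_le_pi_div_two (by linarith) (by linarith) (by linarith)

lemma pi_div_pos {n : ℕ} (hn : 4 ≤ n) : 0 < Real.pi / n :=
  div_pos Real.pi_pos (by exact_mod_cast (by omega : 0 < n))

lemma pi_div_lt {n : ℕ} (hn : 4 ≤ n) : Real.pi / n < Real.pi / 2 :=
  div_lt_div_of_pos_left Real.pi_pos two_pos (by exact_mod_cast (by omega : 2 < n))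

lemma sin_pi_div_pos {n : ℕ} (hn : 4 ≤ n) : 0 < Real.sin (Real.pi / n) :=
  Real.sin_pos_of_pos_of_lt_pi (pi_div_pos hn) (by linarith [pi_div_lt hn, Real.pi_pos])

lemma cos_pi_div_pos {n : ℕ} (hn : 4 ≤ n) : 0 < Real.cos (Real.pi / n) :=
  Real.cos_pos_of_mem_Ioo ⟨by linarith [pi_div_pos hn, Real.pi_pos], pi_div_lt hn⟩

lemma rpoly_of_odd {n k : ℕ} (h : n = 2 * k + 1) :
    rpoly n = 1 + (2 * Real.cos (Real.pi / n) ^ 2 - 1) / Real.cos (Real.pi / n) := by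
  have : ¬ Even n := by rw [Nat.not_even_iff_odd]; exact ⟨k, h⟩
  rw [rpoly, if_neg this, ← Real.cos_two_mul, mul_div_assoc]

/-- If the height of a later point over the line of the first edge is measured at a point which
does not advance along the edge direction, this height is at least `r_n`. -/
lemma rpoly_le_re_sub {n : ℕ} (hn : 4 ≤ n) {m z : ℝ} (hm0 : 0 ≤ m) (hm1 : m < 1) (hmz : m < z)
    (hz : z ≤ m + n / 2)
    (him : (midRot n * polyCurve n z).im ≤ (midRot n * polyCurve n m).im) :
    rpoly n ≤ (midRot n * polyCurve n m).re - (midRot n * polyCurve n z).re := by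
  have hs := sin_pi_div_pos hn
  have hc := cos_pi_div_pos hn
  have hc1 := Real.cos_le_one (Real.pi / n)
  have ha := pi_div_pos hn
  have hna : n * (Real.pi / n) = Real.pi := by
    field_simp
  obtain ⟨j, hj⟩ : ∃ j : ℕ, (j : ℤ) = ⌊z⌋ := ⟨⌊z⌋.toNat, Int.toNat_of_nonneg
    (Int.floor_nonneg.2 (hm0.trans hmz.le))⟩
  have hz0 : ((j : ℤ) : ℝ) ≤ z := hj ▸ Int.floor_le z
  have hz1 : z < ((j : ℤ) : ℝ) + 1 := hj ▸ Int.lt_floor_add_one z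
  rw [midRot_mul_polyCurve_im_zero n hm0 hm1.le, midRot_mul_polyCurve_im n j hz0 hz1.le] at him
  rw [midRot_mul_polyCurve_re_zero n hm0 hm1.le, midRot_mul_polyCurve_re n j hz0 hz1.le]
  push_cast at *
  set a := Real.pi / n
  set s := Real.sin a
  set c := Real.cos a
  have him' : (1 - (z - j)) * Real.sin ((2 * j - 1) * a) + (z - j) * Real.sin ((2 * j + 1) * a)
      < s := him.trans_lt (by nlinarith)
  have hjn : n ≤ 2 * j + 1 := by
    by_contra! hlt
    rcases Nat.eq_zero_or_pos j with rfl | hpos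
    · simp at him
      have : 0 < (z - m) * s := mul_pos (by linarith) hs
      simp only [s] at *
      nlinarith
    · have hj1 : (1 : ℝ) ≤ j := by exact_mod_cast hpos
      have hj2 : (2 * j + 2 : ℝ) ≤ n := by exact_mod_cast hlt
      have h3 : (2 * j + 2 : ℝ) * a ≤ Real.pi := hna ▸ mul_le_mul_of_nonneg_right hj2 ha.le
      have h1 : s ≤ Real.sin ((2 * j - 1) * a) :=
        sin_le_sin_of_mem_Icc ha.le (by nlinarith) (by nlinarith)
      have h2 : s ≤ Real.sin ((2 * j + 1) * a) :=
        sin_le_sin_of_mem_Icc ha.le (by nlinarith) (by nlinarith)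
      nlinarith
  rcases Nat.even_or_odd' n with ⟨k, hk | hk⟩
  · have hkn : (n : ℝ) = 2 * k := by exact_mod_cast hk
    have hjk : j = k := by
      have : (j : ℝ) < k + 1 := by linarith
      have : j < k + 1 := by exact_mod_cast this
      omega
    subst hjk
    have e1 : (2 * j - 1 : ℝ) * a = Real.pi - a := by rw [← hna, hkn]; ring
    have e2 : (2 * j + 1 : ℝ) * a = a + Real.pi := by rw [← hna, hkn]; ring
    rw [e1, e2, Real.cos_pi_sub, Real.cos_add_pi, rpoly, if_pos ⟨j, by omega⟩]
    linarith
  · have hkn : (n : ℝ) = 2 * k + 1 := by exact_mod_cast hk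
    rw [rpoly_of_odd hk]
    have hcc : 1 + (2 * c ^ 2 - 1) / c = (c + 2 * c ^ 2 - 1) / c := by field_simp; ring
    rw [hcc, div_le_iff₀ hc]
    have hjk : j = k ∨ j = k + 1 := by
      have : (j : ℝ) < k + 2 := by linarith
      have : j < k + 2 := by exact_mod_cast this
      omega
    rcases hjk with rfl | rfl
    · have e1 : (2 * j - 1 : ℝ) * a = Real.pi - 2 * a := by rw [← hna, hkn]; ring
      have e2 : (2 * j + 1 : ℝ) * a = Real.pi := by rw [← hna, hkn]
      rw [e1, e2, Real.sin_pi_sub, Real.sin_pi, Real.sin_two_mul] at him'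
      rw [e1, e2, Real.cos_pi_sub, Real.cos_pi, Real.cos_two_mul]
      have h1 : (1 - (z - j)) * (2 * c) < 1 := by
        have : ((1 - (z - j)) * (2 * c)) * s < 1 * s := by nlinarith
        exact lt_of_mul_lt_mul_right this hs.le
      have h2 : 0 ≤ (1 - c ^ 2) * (1 - (1 - (z - j)) * (2 * c)) :=
        mul_nonneg (by nlinarith) (by linarith)
      nlinarith
    · push_cast at *
      have e1 : (2 * (k + 1) - 1 : ℝ) * a = Real.pi := by rw [← hna, hkn]; ring
      have e2 : (2 * (k + 1) + 1 : ℝ) * a = 2 * a + Real.pi := by rw [← hna, hkn]; ring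
      rw [e1, e2, Real.cos_add_pi, Real.cos_pi, Real.cos_two_mul]
      have h1 : z - (k + 1) ≤ 1 / 2 := by linarith
      have h2 : 0 ≤ (1 - c ^ 2) * (1 - 2 * (z - (k + 1))) :=
        mul_nonneg (by nlinarith) (by linarith)
      have h3 : 0 ≤ (1 - c ^ 2) * (1 - c) := mul_nonneg (by nlinarith) (by linarith)
      nlinarith [mul_nonneg hc.le h2]

lemma rpoly_le_dist_or_im_lt {n : ℕ} (hn : 4 ≤ n) {m z : ℝ} (hm0 : 0 ≤ m) (hm1 : m < 1)
    (hmz : m < z) (hz : z ≤ m + n / 2) :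
    rpoly n ≤ dist (polyCurve n m) (polyCurve n z) ∨
      (midRot n * polyCurve n m).im < (midRot n * polyCurve n z).im := by
  refine or_iff_not_imp_right.2 fun h ↦ ?_
  refine (rpoly_le_re_sub hn hm0 hm1 hmz hz (not_lt.1 h)).trans ?_
  rw [← Complex.sub_re, ← mul_sub]
  refine (Complex.re_le_norm _).trans ?_
  rw [norm_mul, norm_midRot, one_mul, dist_eq_norm]

/-- Below distance `r_n`, moving forward strictly decreases the distance to a point ahead within
half a turn. -/
lemma exists_dist_lt_of_lt_rpoly {n : ℕ} (hn : 4 ≤ n) {m z : ℝ} (hmz : m < z)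
    (hz : z ≤ m + n / 2) (hd : dist (polyCurve n m) (polyCurve n z) < rpoly n)
    {ε : ℝ} (hε : 0 < ε) :
    ∃ δ, 0 < δ ∧ δ < ε ∧
      dist (polyCurve n (m + δ)) (polyCurve n z) < dist (polyCurve n m) (polyCurve n z) := by
  wlog hm : 0 ≤ m ∧ m < 1 generalizing m z
  · have h0 := Int.floor_le m
    have h1 := Int.lt_floor_add_one m
    obtain ⟨δ, hδ0, hδ1, h⟩ := @this (m + (-⌊m⌋ : ℤ)) (z + (-⌊m⌋ : ℤ)) (by linarith) (by linarith)
      (by rwa [dist_polyCurve_add_int]) (by push_cast; constructor <;> linarith)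
    refine ⟨δ, hδ0, hδ1, ?_⟩
    rwa [add_right_comm, dist_polyCurve_add_int, dist_polyCurve_add_int] at h
  obtain ⟨hm0, hm1⟩ := hm
  have him := (rpoly_le_dist_or_im_lt hn hm0 hm1 hmz hz).resolve_left hd.not_ge
  have hs := sin_pi_div_pos hn
  set g := (midRot n * polyCurve n z).im - (midRot n * polyCurve n m).im with hg
  have hg0 : 0 < g := by linarith
  have key (w v : ℂ) : dist w v ^ 2 = ((midRot n * w).re - (midRot n * v).re) ^ 2 +
      ((midRot n * w).im - (midRot n * v).im) ^ 2 := by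
    rw [← Complex.sub_re, ← Complex.sub_im, ← mul_sub, dist_eq_norm]
    have := Complex.sq_norm (midRot n * (w - v))
    rw [norm_mul, norm_midRot, one_mul, Complex.normSq_apply] at this
    rw [this]; ring
  obtain ⟨δ, hδ0, hδ⟩ := exists_between (lt_min hε (lt_min (sub_pos.2 hm1)
    (div_pos hg0 (mul_pos two_pos hs))))
  obtain ⟨hδ1, hδ⟩ := lt_min_iff.1 hδ
  obtain ⟨hδ2, hδ3⟩ := lt_min_iff.1 hδ
  rw [lt_div_iff₀ (mul_pos two_pos hs)] at hδ3
  refine ⟨δ, hδ0, hδ1, lt_of_pow_lt_pow_left₀ 2 dist_nonneg ?_⟩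
  rw [key, key, midRot_mul_polyCurve_re_zero n hm0 hm1.le,
    midRot_mul_polyCurve_re_zero n (by linarith) (by linarith : m + δ ≤ 1)]
  rw [midRot_mul_polyCurve_im_zero n hm0 hm1.le] at hg ⊢
  rw [midRot_mul_polyCurve_im_zero n (by linarith) (by linarith : m + δ ≤ 1)]
  have : 0 < δ * (2 * Real.sin (Real.pi / n)) := by positivity
  nlinarith

/-- Below `r_n`, the distance to a point ahead within half a turn does not increase when moving
forward. -/
lemma dist_polyCurve_le {n : ℕ} (hn : 4 ≤ n) {x y z : ℝ} (hxy : x ≤ y) (hyz : y ≤ z)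
    (hz : z ≤ x + n / 2) (hd : dist (polyCurve n x) (polyCurve n z) < rpoly n) :
    dist (polyCurve n y) (polyCurve n z) ≤ dist (polyCurve n x) (polyCurve n z) := by
  obtain ⟨m, hm, hmin⟩ := isCompact_Icc.exists_isMinOn (Set.nonempty_Icc.2 hxy)
    ((continuous_polyCurve n).dist continuous_const :
      Continuous fun s ↦ dist (polyCurve n s) (polyCurve n z)).continuousOn
  have hmx := hmin (Set.left_mem_Icc.2 hxy)
  simp only [Set.mem_ofPred_eq] at hmx
  rcases hm.2.lt_or_eq with hlt | rfl
  · obtain ⟨δ, hδ0, hδ1, h⟩ := exists_dist_lt_of_lt_rpoly hn (hlt.trans_le hyz)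
      (by linarith [hm.1]) (hmx.trans_lt hd) (sub_pos.2 hlt)
    exact absurd (hmin (show m + δ ∈ Set.Icc x y from ⟨by linarith [hm.1], by linarith⟩)) h.not_ge
  · exact hmx

lemma cos_pi_div_le_norm_polyCurve (n : ℕ) (s : ℝ) :
    Real.cos (Real.pi / n) ≤ ‖polyCurve n s‖ := by
  have h : polyCurve n s = nroot n ^ ⌊s⌋ * polyCurve n (Int.fract s) := by
    rw [← polyCurve_add_int, Int.fract_add_floor]
  rw [h, norm_mul, norm_nroot_zpow, one_mul,
    ← midRot_mul_polyCurve_re_zero n (Int.fract_nonneg s) (Int.fract_lt_one s).le]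
  refine (Complex.re_le_norm _).trans ?_
  rw [norm_mul, norm_midRot, one_mul]

/-- Points half a turn apart are at distance at least `r_n`. -/
lemma rpoly_le_dist_half_turn {n : ℕ} (hn : 4 ≤ n) (x : ℝ) :
    rpoly n ≤ dist (polyCurve n x) (polyCurve n (x + n / 2)) := by
  have hn0 : n ≠ 0 := by omega
  have hna : n * (Real.pi / n) = Real.pi := by field_simp
  rcases Nat.even_or_odd' n with ⟨k, hk | hk⟩
  · have hkn : (n : ℝ) = 2 * k := by exact_mod_cast hk
    have e : x + (n : ℝ) / 2 = x + (k : ℤ) := by rw [hkn]; push_cast; ring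
    have hw : nroot n ^ (k : ℤ) = -1 := by
      rw [nroot, ← Complex.exp_int_mul, ← Complex.exp_pi_mul_I]
      congr 1
      have : (n : ℂ) = 2 * k := by exact_mod_cast hk
      have hk0 : (k : ℂ) ≠ 0 := by
        norm_cast; omega
      rw [this]; push_cast; field_simp
    rw [e, polyCurve_add_int, hw, dist_eq_norm, neg_one_mul, sub_neg_eq_add, ← two_mul, norm_mul,
      rpoly, if_pos ⟨k, by omega⟩]
    simpa using cos_pi_div_le_norm_polyCurve n x
  · have hkn : (n : ℝ) = 2 * k + 1 := by exact_mod_cast hk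
    wlog hx : 0 ≤ x ∧ x ≤ 1 / 2 generalizing x
    · have h0 := Int.floor_le x
      have h1 := Int.lt_floor_add_one x
      rcases le_or_gt x (⌊x⌋ + 1 / 2) with h2 | h2
      · have := this (x + (-⌊x⌋ : ℤ)) (by push_cast; constructor <;> linarith)
        rwa [add_right_comm, dist_polyCurve_add_int] at this
      · have := this (x + n / 2 + (-⌊x⌋ - k - 1 : ℤ))
          (by push_cast; constructor <;> linarith)
        rw [add_right_comm (x + (n : ℝ) / 2), dist_polyCurve_add_int] at this
        have e : x + n / 2 + (n : ℝ) / 2 = x + n * (1 : ℤ) := by push_cast; ring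
        rwa [e, polyCurve_add_int_mul hn0, dist_comm] at this
    obtain ⟨hx0, hx1⟩ := hx
    have hs := sin_pi_div_pos hn
    have hc := cos_pi_div_pos hn
    have hc1 := Real.cos_le_one (Real.pi / n)
    have hz0 : (((k : ℕ) : ℤ) : ℝ) ≤ x + n / 2 := by push_cast; linarith
    have hz1 : x + n / 2 ≤ (((k : ℕ) : ℤ) : ℝ) + 1 := by push_cast; linarith
    have e1 : (2 * k - 1 : ℝ) * (Real.pi / n) = Real.pi - 2 * (Real.pi / n) := by
      linear_combination hna - (Real.pi / n) * hkn
    have e2 : (2 * k + 1 : ℝ) * (Real.pi / n) = Real.pi := by rw [← hkn, hna]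
    have hre := midRot_mul_polyCurve_re n k hz0 hz1
    have him := midRot_mul_polyCurve_im n k hz0 hz1
    push_cast at hre him
    rw [e1, e2, Real.cos_pi_sub, Real.cos_pi, Real.cos_two_mul] at hre
    rw [e1, e2, Real.sin_pi_sub, Real.sin_pi, Real.sin_two_mul] at him
    have hsq : dist (polyCurve n x) (polyCurve n (x + n / 2)) ^ 2 =
        ((midRot n * polyCurve n x).re - (midRot n * polyCurve n (x + n / 2)).re) ^ 2 +
        ((midRot n * polyCurve n x).im - (midRot n * polyCurve n (x + n / 2)).im) ^ 2 := by
      rw [← Complex.sub_re, ← Complex.sub_im, ← mul_sub, dist_eq_norm]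
      have := Complex.sq_norm (midRot n * (polyCurve n x - polyCurve n (x + n / 2)))
      rw [norm_mul, norm_midRot, one_mul, Complex.normSq_apply] at this
      rw [this]; ring
    rw [hre, him, midRot_mul_polyCurve_re_zero n hx0 (by linarith),
      midRot_mul_polyCurve_im_zero n hx0 (by linarith)] at hsq
    rw [rpoly_of_odd hk]
    have hsc := Real.sin_sq_add_cos_sq (Real.pi / n)
    set c := Real.cos (Real.pi / n)
    set s := Real.sin (Real.pi / n)
    have hk2 : (k : ℝ) = (n - 1) / 2 := by linarith
    have hD : dist (polyCurve n x) (polyCurve n (x + n / 2)) ^ 2 =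
        (1 + c) ^ 2 * (1 - 4 * x * (1 - 2 * x) * (1 - c)) := by
      rw [hsq, hk2]
      have : s ^ 2 = 1 - c ^ 2 := by linarith
      linear_combination (1 - 2 * x) ^ 2 * (1 + c) ^ 2 * this
    have h1 : ((1 + c) ^ 2 / 2) ^ 2 ≤ dist (polyCurve n x) (polyCurve n (x + n / 2)) ^ 2 := by
      rw [hD]
      have h2 : 4 * x * (1 - 2 * x) ≤ 1 / 2 := by nlinarith [sq_nonneg (4 * x - 1)]
      have h3 : ((1 + c) / 2) ^ 2 ≤ 1 - 4 * x * (1 - 2 * x) * (1 - c) := by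
        have := mul_le_mul_of_nonneg_right h2 (sub_nonneg.2 hc1)
        have := mul_nonneg (sub_nonneg.2 hc1) (by linarith : 0 ≤ 1 + c)
        linarith
      calc ((1 + c) ^ 2 / 2) ^ 2 = (1 + c) ^ 2 * ((1 + c) / 2) ^ 2 := by ring
        _ ≤ _ := mul_le_mul_of_nonneg_left h3 (sq_nonneg _)
    have h2 := le_of_sq_le_sq h1 dist_nonneg
    refine le_trans ?_ h2
    have hcc : 1 + (2 * c ^ 2 - 1) / c = (c + 2 * c ^ 2 - 1) / c := by field_simp; ring
    rw [hcc, div_le_iff₀ hc]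
    have := mul_nonneg (mul_nonneg (sub_nonneg.2 hc1) (by linarith : 0 ≤ 2 - c))
      (by linarith : 0 ≤ 1 + c)
    linarith

lemma polyCurve_ne {n : ℕ} (hn : 4 ≤ n) (hr : 0 < rpoly n) {m z : ℝ} (hmz : m < z)
    (hz : z < m + n) : polyCurve n m ≠ polyCurve n z := by
  wlog hhalf : z ≤ m + n / 2 generalizing m z
  · have h := @this z (m + n * (1 : ℤ)) (by push_cast; linarith) (by push_cast; linarith)
      (by push_cast; linarith)
    rw [polyCurve_add_int_mul (by omega)] at h
    exact h.symm
  wlog hm : 0 ≤ m ∧ m < 1 generalizing m z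
  · have h0 := Int.floor_le m
    have h1 := Int.lt_floor_add_one m
    have h := @this (m + (-⌊m⌋ : ℤ)) (z + (-⌊m⌋ : ℤ)) (by linarith) (by linarith) (by linarith)
      (by push_cast; constructor <;> linarith)
    rw [polyCurve_add_int, polyCurve_add_int] at h
    exact fun heq ↦ h (by rw [heq])
  intro heq
  rcases rpoly_le_dist_or_im_lt hn hm.1 hm.2 hmz hhalf with h | h
  · rw [heq, dist_self] at h
    exact h.not_gt hr
  · rw [heq] at h
    exact h.false

lemma polyArg_polyCurve {n : ℕ} (hn : 4 ≤ n) (hr : 0 < rpoly n) {q : ℝ}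
    (hq : q ∈ Set.Ico (0 : ℝ) 1) : polyArg n (polyCurve n (n * q)) = q := by
  have hn0 : (0 : ℝ) < n := by exact_mod_cast (by omega : 0 < n)
  have : {t : ℝ | t ∈ Set.Ico (0 : ℝ) 1 ∧ polyParam n t = polyCurve n (n * q)} = {q} := by
    ext t
    simp only [Set.mem_ofPred_eq, Set.mem_singleton_iff, polyParam_eq_polyCurve]
    refine ⟨fun ⟨ht, h⟩ ↦ ?_, fun h ↦ h.symm ▸ ⟨hq, rfl⟩⟩
    rcases lt_trichotomy t q with hlt | heq | hlt
    · exact absurd h (polyCurve_ne hn hr (by nlinarith) (by nlinarith [hq.2, ht.1]))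
    · exact heq
    · exact absurd h.symm (polyCurve_ne hn hr (by nlinarith) (by nlinarith [ht.2, hq.1]))
  rw [polyArg, this, csInf_singleton]

lemma polyCurve_mul_fract {n : ℕ} (hn : n ≠ 0) (q : ℝ) :
    polyCurve n (n * Int.fract q) = polyCurve n (n * q) := by
  rw [← polyCurve_add_int_mul hn (n * Int.fract q) ⌊q⌋, ← mul_add, Int.fract_add_floor]

lemma polyArg_polyCurve_fract {n : ℕ} (hn : 4 ≤ n) (hr : 0 < rpoly n) (q : ℝ) :
    polyArg n (polyCurve n (n * q)) = Int.fract q := by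
  rw [← polyCurve_mul_fract (by omega),
    polyArg_polyCurve hn hr ⟨Int.fract_nonneg q, Int.fract_lt_one q⟩]

lemma polyCurve_mem_polygon {n : ℕ} (hn : n ≠ 0) (s : ℝ) : polyCurve n s ∈ polygon n := by
  have hn' : (n : ℤ) ≠ 0 := by exact_mod_cast hn
  have hpos : (0 : ℤ) < n := by omega
  set j := (⌊s⌋ % n).toNat with hj
  have hj' : (j : ℤ) = ⌊s⌋ % n := Int.toNat_of_nonneg (Int.emod_nonneg _ hn')
  have hz : nroot n ^ ⌊s⌋ = nroot n ^ j := by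
    conv_lhs => rw [← Int.emod_add_mul_ediv ⌊s⌋ n, zpow_add₀ (nroot_ne_zero n), zpow_mul,
      zpow_natCast, nroot_pow_self hn, one_zpow, mul_one, ← hj', zpow_natCast]
  have hlt := Int.emod_lt_of_pos ⌊s⌋ hpos
  refine Set.mem_biUnion (x := j) (Finset.mem_coe.2 (Finset.mem_range.2 (by omega))) ?_
  refine ⟨1 - Int.fract s, Int.fract s, by linarith [Int.fract_lt_one s], Int.fract_nonneg s,
    by ring, ?_⟩
  rw [polyCurve, zpow_add_one₀ (nroot_ne_zero n), hz, pow_succ, Complex.real_smul,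
    Complex.real_smul]

lemma exists_polyCurve_eq {n : ℕ} {x : ℂ} (hx : x ∈ polygon n) : ∃ s, polyCurve n s = x := by
  obtain ⟨j, -, a, b, ha, hb, hab, rfl⟩ : ∃ j ∈ Finset.range n,
      x ∈ segment ℝ (nroot n ^ j) (nroot n ^ (j + 1)) := by
    simpa only [polygon, Set.mem_iUnion, exists_prop] using hx
  refine ⟨j + b, ?_⟩
  rw [polyCurve_eq_of_mem_Icc n j (by push_cast; linarith) (by push_cast; linarith)]
  have h1 : (1 - (j + b - ((j : ℕ) : ℤ)) : ℝ) = a := by push_cast; linarith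
  have h2 : (j + b - ((j : ℕ) : ℤ) : ℝ) = b := by push_cast; ring
  rw [h1, h2, Complex.real_smul, Complex.real_smul]
  norm_cast

lemma polyCurve_polyArg {n : ℕ} (hn : 4 ≤ n) (hr : 0 < rpoly n) {x : ℂ} (hx : x ∈ polygon n) :
    polyCurve n (n * polyArg n x) = x := by
  obtain ⟨s, rfl⟩ := exists_polyCurve_eq hx
  have hn0 : (n : ℝ) ≠ 0 := by exact_mod_cast (by omega : n ≠ 0)
  have hs : s = n * (s / n) := by field_simp
  rw [hs, polyArg_polyCurve_fract hn hr, polyCurve_mul_fract (by omega)]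

/-- A star lifts to an increasing sequence of parameters on the universal cover of `P_n`. -/
lemma IsStar.exists_lift {n l : ℕ} {r : ℝ} {p : ℂ} {u : ℕ → ℂ} (hn : 4 ≤ n) (hr0 : 0 < r)
    (hr : r < rpoly n) (h : IsStar n l r p u) :
    ∃ S : ℕ → ℝ, S 0 = n * polyArg n p ∧ S (2 * l + 1) = n * polyArg n p + n * l ∧
      (∀ i ≤ 2 * l + 1, polyCurve n (S i) = u i) ∧
      ∀ i ≤ 2 * l, S i < S (i + 1) ∧ dist (polyCurve n (S i)) (polyCurve n (S (i + 1))) = r ∧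
        ∀ z, S i < z → z < S (i + 1) → dist (polyCurve n (S i)) (polyCurve n z) < r := by
  obtain ⟨hu0, -, hmem, hdist, hbtw, hsum⟩ := h
  have hrp := hr0.trans hr
  have hn0 : (0 : ℝ) < n := by exact_mod_cast (by omega : 0 < n)
  set T : ℕ → ℝ := fun i ↦ polyArg n p + ∑ j ∈ Finset.range i, polyDist n (u j) (u (j + 1))
    with hT
  have hTs (i : ℕ) : T (i + 1) = T i + polyDist n (u i) (u (i + 1)) := by
    simp only [hT, Finset.sum_range_succ]; ring
  have hTk (i : ℕ) : ∃ k : ℤ, T i = polyArg n (u i) + k := by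
    induction i with
    | zero => exact ⟨0, by simp [hT, hu0]⟩
    | succ i ih =>
      obtain ⟨k, hk⟩ := ih
      refine ⟨k - ⌊polyArg n (u (i + 1)) - polyArg n (u i)⌋, ?_⟩
      rw [hTs, hk, polyDist, Int.fract]; push_cast; ring
  have hcurve (i : ℕ) (hi : i ≤ 2 * l + 1) : polyCurve n (n * T i) = u i := by
    obtain ⟨k, hk⟩ := hTk i
    rw [hk, mul_add, polyCurve_add_int_mul (by omega), polyCurve_polyArg hn hrp (hmem i hi)]
  refine ⟨fun i ↦ n * T i, by simp [hT], ?_, hcurve, fun i hi ↦ ?_⟩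
  · simp only [hT, hsum]; ring
  have hd : dist (polyCurve n (n * T i)) (polyCurve n (n * T (i + 1))) = r := by
    rw [hcurve i (by omega), hcurve (i + 1) (by omega), hdist i hi]
  have hnn : 0 ≤ polyDist n (u i) (u (i + 1)) := Int.fract_nonneg _
  have hlt1 : polyDist n (u i) (u (i + 1)) < 1 := Int.fract_lt_one _
  refine ⟨?_, hd, fun z hz1 hz2 ↦ ?_⟩
  · refine mul_lt_mul_of_pos_left (lt_of_le_of_ne (by rw [hTs]; linarith) fun heq ↦ ?_) hn0
    rw [heq, dist_self] at hd
    exact hr0.ne hd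
  · obtain ⟨q, rfl⟩ : ∃ q : ℝ, z = n * q := ⟨z / n, by field_simp⟩
    have hq1 : T i < q := lt_of_mul_lt_mul_left hz1 hn0.le
    have hq2 : q < T (i + 1) := lt_of_mul_lt_mul_left hz2 hn0.le
    rw [hTs] at hq2
    have hpd : polyDist n (u i) (polyCurve n (n * q)) = q - T i := by
      obtain ⟨k, hk⟩ := hTk i
      rw [polyDist, polyArg_polyCurve_fract hn hrp, Int.fract_eq_iff]
      refine ⟨by linarith, by linarith, k - ⌊q⌋, ?_⟩
      rw [hk, Int.fract]; push_cast; ring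
    rw [hcurve i (by omega)]
    exact hbtw i hi _ (polyCurve_mem_polygon (by omega) _)
      ⟨by rw [hpd]; linarith, by rw [hpd]; linarith⟩

/-- The next point at larger distance from a later starting point comes strictly later. -/
lemma next_lt_next {n : ℕ} (hn : 4 ≤ n) {r r' s t s' t' : ℝ} (hr : r < rpoly n) (hrr : r < r')
    (hst : s < t) (hd : dist (polyCurve n s) (polyCurve n t) = r)
    (hbtw : ∀ z, s < z → z < t → dist (polyCurve n s) (polyCurve n z) < r)
    (hst' : s' < t') (hd' : dist (polyCurve n s') (polyCurve n t') = r') (hss : s ≤ s') :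
    t < t' := by
  by_contra! hle
  have hhalf : t ≤ s + n / 2 := by
    have hn0 : (0 : ℝ) < n := by exact_mod_cast (by omega : 0 < n)
    by_contra! hlt
    exact ((rpoly_le_dist_half_turn hn s).trans_lt (hbtw _ (by linarith) hlt)).not_gt hr
  have h : dist (polyCurve n s) (polyCurve n t') ≤ r := by
    rcases hle.lt_or_eq with hlt | rfl
    · exact (hbtw _ (hss.trans_lt hst') hlt).le
    · exact hd.le
  have := dist_polyCurve_le hn hss hst'.le (hle.trans hhalf) (h.trans_lt hr)
  linarith

lemma IsStar.not_lt {n l : ℕ} {r r' : ℝ} {p : ℂ} {u u' : ℕ → ℂ} (hn : 4 ≤ n) (hr0 : 0 < r)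
    (hr0' : 0 < r') (hr' : r' < rpoly n) (hs : IsStar n l r p u) (hs' : IsStar n l r' p u') :
    ¬ r < r' := by
  intro hrr
  have hr := hrr.trans hr'
  obtain ⟨S, hS0, hSl, -, hS⟩ := hs.exists_lift hn hr0 hr
  obtain ⟨S', hS0', hSl', -, hS'⟩ := hs'.exists_lift hn hr0' hr'
  have hlt (i : ℕ) (hi : i ≤ 2 * l) (hle : S i ≤ S' i) : S (i + 1) < S' (i + 1) :=
    next_lt_next hn hr hrr (hS i hi).1 (hS i hi).2.1 (hS i hi).2.2 (hS' i hi).1 (hS' i hi).2.1 hle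
  have hle (i : ℕ) (hi : i ≤ 2 * l) : S i ≤ S' i := by
    induction i with
    | zero => rw [hS0, hS0']
    | succ i ih => exact (hlt i (by omega) (ih (by omega))).le
  have := hlt (2 * l) le_rfl (hle _ le_rfl)
  rw [hSl, hSl'] at this
  exact this.false

/-- Uniqueness of inscribed equilateral `(2l+1)`-pointed stars: if two inscribed equilateral
`(2l+1)`-pointed stars based at the same point `p ∈ P_n` have side lengths `r, r' ∈ (0, r_n)`,
then `r = r'` and the stars coincide pointwise. -/
theorem star_unique (n l : ℕ) (hn : 4 ≤ n) (hl : 1 ≤ l) (p : ℂ) (hp : p ∈ polygon n)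
    (r r' : ℝ) (u u' : ℕ → ℂ)
    (hr0 : 0 < r) (hrn : r < rpoly n) (hr0' : 0 < r') (hrn' : r' < rpoly n)
    (hs : IsStar n l r p u) (hs' : IsStar n l r' p u') :
    r = r' ∧ ∀ i ≤ 2 * l + 1, u i = u' i := by
  obtain rfl : r = r' := le_antisymm (not_lt.1 (hs'.not_lt hn hr0' hr0 hrn hs))
    (not_lt.1 (hs.not_lt hn hr0 hr0' hrn' hs'))
  refine ⟨rfl, ?_⟩
  obtain ⟨S, hS0, -, hu, hS⟩ := hs.exists_lift hn hr0 hrn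
  obtain ⟨S', hS0', -, hu', hS'⟩ := hs'.exists_lift hn hr0 hrn
  have heq (i : ℕ) (hi : i ≤ 2 * l + 1) : S i = S' i := by
    induction i with
    | zero => rw [hS0, hS0']
    | succ i ih =>
      have hii := ih (by omega)
      obtain ⟨h1, h2, h3⟩ := hS i (by omega)
      obtain ⟨h1', h2', h3'⟩ := hS' i (by omega)
      rw [← hii] at h1' h2' h3'
      rcases lt_trichotomy (S (i + 1)) (S' (i + 1)) with hlt | h | hlt
      · exact absurd h2 (h3' _ h1 hlt).ne
      · exact h
      · exact absurd h2' (h3 _ h1' hlt).ne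
  intro i hi
  rw [← hu i hi, ← hu' i hi, heq i hi]
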